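/- arXiv:2006.15712 — 2 statements merged into one kernel-verified Lean document; each statement's English description precedes it below -/
import Mathlib

section
/- Suppose θ : K → ℝ is nonnegative with ∑_{k∈K} θ(k) = 1, suppose C > 0, and suppose π : E → ℝ defined by π(n,k) = C^{−1}·(∏_{i=0}^{n−1} λ(i)/μ(i+1))·θ(k) satisfies ∑_{(n,k)∈E} π(n,k) = 1 and the global balance equations ∑_{z∈E} π(z)·q(z;z̃) = 0 for every z̃ ∈ E. Then ∑_{n=0}^∞ ∏_{i=0}^{n−1} λ(i)/μ(i+1) < ∞ and θ satisfies ∑_{m∈K} θ(m)·q̃_red^{(n)}(m,k) = 0 for every n ∈ ℕ and every k ∈ K. (Theorem 3.1(b), direction (i)⇒(ii)) -/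
open scoped Classical

noncomputable section

/-- Off-diagonal transition rates of the queueing-environment generator `Q` on `E = ℕ × K`. -/
def qoff {K : Type*} (KW : Set K) (lam mu : ℕ → ℝ) (R V : ℕ → K → K → ℝ)
    (z z' : ℕ × K) : ℝ :=
  if z' = z then 0
  else if z'.1 = z.1 + 1 ∧ z'.2 = z.2 then (if z.2 ∈ KW then lam z.1 else 0)
  else if z'.1 + 1 = z.1 then (if z.2 ∈ KW then mu z.1 * R z.1 z.2 z'.2 else 0)
  else if z'.1 = z.1 then V z.1 z.2 z'.2
  else 0

/-- The queueing-environment generator `Q` on `E = ℕ × K`. -/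
def qgen {K : Type*} (KW : Set K) (lam mu : ℕ → ℝ) (R V : ℕ → K → K → ℝ)
    (z z' : ℕ × K) : ℝ :=
  if z' = z then -∑' w : ℕ × K, qoff KW lam mu R V z w
  else qoff KW lam mu R V z z'

/-- The reduced generator `Q̃_red^{(n)}` on the environment space `K`. -/
def qred {K : Type*} (KW : Set K) (lam : ℕ → ℝ) (R V : ℕ → K → K → ℝ)
    (n : ℕ) (k m : K) : ℝ :=
  if m = k then
    -((if k ∈ KW then lam n * (1 - R (n + 1) k k) else 0)
      + ∑' m' : K, (if m' = k then 0 else V n k m'))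
  else (if k ∈ KW then lam n * R (n + 1) k m else 0) + V n k m

/-- A function on `ℕ × K` supported on one level sums to its sum over that level. -/
theorem hasSum_level {K : Type*} {g : K → ℝ} {s : ℝ} (a : ℕ) (h : HasSum g s) :
    HasSum (fun z : ℕ × K => if z.1 = a then g z.2 else 0) s := by
  have hinj : Function.Injective (fun k : K => (a, k)) := fun x y hxy => (Prod.mk.inj hxy).2
  refine (hinj.hasSum_iff ?_).1 (by simpa [Function.comp_def] using h)
  rintro ⟨b, k⟩ hb
  have : b ≠ a := by
    rintro rfl
    exact hb ⟨k, rfl⟩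
  simp [this]

/-- The total off-diagonal rate out of a state of the queueing-environment process. -/
theorem hasSum_qoff {K : Type*} (KW : Set K) (lam mu : ℕ → ℝ) (R V : ℕ → K → K → ℝ)
    (hmu0 : mu 0 = 0) (hRrow : ∀ n, 0 < n → ∀ k, HasSum (R n k) 1)
    (hVsum : ∀ n k, Summable (V n k)) (n : ℕ) (k : K) :
    HasSum (qoff KW lam mu R V (n, k))
      ((if k ∈ KW then lam n else 0) + (if k ∈ KW then mu n else 0)
        + ∑' m, if m = k then 0 else V n k m) := by
  have hup : HasSum (fun w : ℕ × K => if w.1 = n + 1 then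
      (if w.2 = k then (if k ∈ KW then lam n else 0) else 0) else 0)
      (if k ∈ KW then lam n else 0) :=
    hasSum_level (g := fun m => if m = k then (if k ∈ KW then lam n else 0) else 0) (n + 1)
      (hasSum_ite_eq k (if k ∈ KW then lam n else 0))
  have hdown : HasSum (fun w : ℕ × K => if w.1 + 1 = n then
      (if k ∈ KW then mu n * R n k w.2 else 0) else 0) (if k ∈ KW then mu n else 0) := by
    cases n with
    | zero => simp [hmu0]
    | succ n =>
      simp only [Nat.add_right_cancel_iff]
      refine hasSum_level (g := fun m => if k ∈ KW then mu (n + 1) * R (n + 1) k m else 0) n ?_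
      split_ifs
      · simpa using (hRrow (n + 1) n.succ_pos k).mul_left (mu (n + 1))
      · exact hasSum_zero
  have henv : HasSum (fun w : ℕ × K => if w.1 = n then
      (if w.2 = k then 0 else V n k w.2) else 0) (∑' m, if m = k then 0 else V n k m) := by
    have hs : Summable (fun m => if m = k then 0 else V n k m) := by
      refine ((hVsum n k).sub (hasSum_ite_eq k (V n k k)).summable).congr fun m => ?_
      by_cases h : m = k
      · subst h; simp
      · simp [h]
    exact hasSum_level (g := fun m => if m = k then 0 else V n k m) n hs.hasSum
  convert (hup.add hdown).add henv using 1
  funext ⟨b, m⟩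
  simp only [qoff, Prod.mk.injEq]
  grind

/-- Theorem 3.1(b), direction (i) ⇒ (ii): if the product-form vector
`π(n,k) = C⁻¹·(∏_{i<n} λ(i)/μ(i+1))·θ(k)` is a probability distribution solving the
global balance equations of `Q`, then the summability condition holds and `θ` solves all
reduced-generator equations. -/
theorem reduced_solution_of_product_form
    {K : Type*} [Countable K] [Nonempty K]
    (KW : Set K) (hKW : KW.Nonempty)
    (lam mu : ℕ → ℝ) (R V : ℕ → K → K → ℝ)
    (hlam : ∀ n, 0 < lam n)
    (hmu0 : mu 0 = 0) (hmu : ∀ n, 0 < n → 0 < mu n)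
    (hRnn : ∀ n, 0 < n → ∀ k m, 0 ≤ R n k m)
    (hRrow : ∀ n, 0 < n → ∀ k, HasSum (R n k) 1)
    (hVoff : ∀ n k m, m ≠ k → 0 ≤ V n k m)
    (hVsum : ∀ n k, Summable (V n k))
    (hVrow : ∀ n k, ∑' m, V n k m = 0)
    (theta : K → ℝ) (hth0 : ∀ k, 0 ≤ theta k) (hth1 : ∑' k : K, theta k = 1)
    (C : ℝ) (hCpos : 0 < C)
    (hsum1 : (∑' z : ℕ × K,
        C⁻¹ * (∏ i ∈ Finset.range z.1, lam i / mu (i + 1)) * theta z.2) = 1)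
    (hbal : ∀ z' : ℕ × K,
      ∑' z : ℕ × K,
        (C⁻¹ * (∏ i ∈ Finset.range z.1, lam i / mu (i + 1)) * theta z.2) *
          qgen KW lam mu R V z z' = 0) :
    Summable (fun n : ℕ => ∏ i ∈ Finset.range n, lam i / mu (i + 1)) ∧
    (∀ (n : ℕ) (k : K), ∑' m : K, theta m * qred KW lam R V n m k = 0) := by
  set p : ℕ → ℝ := fun n => ∏ i ∈ Finset.range n, lam i / mu (i + 1) with hp
  have hp_pos : ∀ n, 0 < p n := fun n =>
    Finset.prod_pos fun i _ => div_pos (hlam i) (hmu _ i.succ_pos)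
  have hp_succ : ∀ n, p (n + 1) * mu (n + 1) = p n * lam n := fun n => by
    have := (hmu (n + 1) n.succ_pos).ne'
    simp only [hp, Finset.prod_range_succ]
    field_simp
  have hth : Summable theta := by
    by_contra h
    simp [tsum_eq_zero_of_not_summable h] at hth1
  constructor
  · obtain ⟨k, hk⟩ : ∃ k, theta k ≠ 0 := by
      by_contra! h
      simp [h] at hth1
    have hs : Summable (fun z : ℕ × K => C⁻¹ * p z.1 * theta z.2) := by
      by_contra h
      exact zero_ne_one ((tsum_eq_zero_of_not_summable h).symm.trans hsum1)
    have hinj : Function.Injective (fun n : ℕ => (n, k)) := fun x y hxy => (Prod.mk.inj hxy).1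
    refine ((hs.comp_injective hinj).mul_left (C * (theta k)⁻¹)).congr fun n => ?_
    simp only [Function.comp_apply]
    field_simp
  intro n k
  by_cases hS : Summable (fun m => theta m * qred KW lam R V n m k)
  swap
  · exact tsum_eq_zero_of_not_summable hS
  obtain ⟨S, hS⟩ := hS
  have hR1 : ∀ m, R (n + 1) m k ≤ 1 := fun m =>
    le_hasSum (hRrow _ n.succ_pos m) k fun j _ => hRnn _ n.succ_pos m j
  have hA : Summable (fun m => theta m * (if m ∈ KW then lam n * R (n + 1) m k else 0)) := by
    refine Summable.of_nonneg_of_le (fun m => ?_) (fun m => ?_) (hth.mul_right (lam n))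
    · refine mul_nonneg (hth0 m) ?_
      split_ifs
      · exact mul_nonneg (hlam n).le (hRnn _ n.succ_pos m k)
      · exact le_rfl
    · refine mul_le_mul_of_nonneg_left ?_ (hth0 m)
      split_ifs
      · exact mul_le_of_le_one_right (hlam n).le (hR1 m)
      · exact (hlam n).le
  obtain ⟨T, hT⟩ := hA
  have hM := hasSum_ite_eq k (theta k * if k ∈ KW then mu n else 0)
  have hbelow : HasSum (fun z : ℕ × K => if z.1 + 1 = n then
      (if z.2 = k then C⁻¹ * p n * (theta k * if k ∈ KW then mu n else 0) else 0) else 0)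
      (C⁻¹ * p n * (theta k * if k ∈ KW then mu n else 0)) := by
    cases n with
    | zero => simp [hmu0]
    | succ n =>
      simp only [Nat.add_right_cancel_iff]
      exact hasSum_level n
        (hasSum_ite_eq k (C⁻¹ * p (n + 1) * (theta k * if k ∈ KW then mu (n + 1) else 0)))
  have hne : ∀ a : ℕ, a ≠ a + 1 + 1 := fun a => by omega
  have hne' : ∀ a : ℕ, a + 1 + 1 ≠ a := fun a => by omega
  have hcol := ((hasSum_level n (((hS.sub hT).sub hM).mul_left (C⁻¹ * p n))).add
    (hasSum_level (n + 1) (hT.mul_left (C⁻¹ * p n)))).add hbelow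
  have hzero := hbal (n, k)
  have hval : HasSum (fun z : ℕ × K => C⁻¹ * p z.1 * theta z.2 * qgen KW lam mu R V z (n, k))
      (C⁻¹ * p n * S) := by
    convert hcol using 1
    · funext z
      obtain ⟨b, m⟩ := z
      rcases lt_trichotomy b n with hb | rfl | hb
      · by_cases hbn : b + 1 = n
        · subst hbn
          have h1 := hp_succ b
          by_cases hm : m = k
          · subst hm
            by_cases hw : m ∈ KW
            · simp [qgen, qoff, hw, hne]
              linear_combination -(C⁻¹ * theta m) * h1
            · simp [qgen, qoff, hw, hne]
          · simp [qgen, qoff, hm, Ne.symm hm, hne, hne']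
        · have h1 : b ≠ n := hb.ne
          have h2 : n ≠ b + 1 := Ne.symm hbn
          have h3 : n + 1 ≠ b := by omega
          have h4 : b ≠ n + 1 := h3.symm
          simp [qgen, qoff, h1, h1.symm, h2, h3, h4, hbn]
      · by_cases hm : m = k
        · subst hm
          simp only [qgen, qred, if_true,
            (hasSum_qoff KW lam mu R V hmu0 hRrow hVsum b m).tsum_eq]
          by_cases hw : m ∈ KW
          · simp [hw]
            ring
          · simp [hw]
            ring
        · by_cases hw : m ∈ KW
          · simp [qgen, qoff, qred, hm, Ne.symm hm, hw]
            ring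
          · simp [qgen, qoff, qred, hm, Ne.symm hm, hw]
            ring
      · by_cases hbn : b = n + 1
        · subst hbn
          have h1 := hp_succ n
          by_cases hw : m ∈ KW
          · simp [qgen, qoff, hw, hne, hne']
            linear_combination (C⁻¹ * theta m * R (n + 1) m k) * h1
          · simp [qgen, qoff, hw, hne, hne']
        · have h1 : b ≠ n := hb.ne'
          have h2 : n ≠ b + 1 := by omega
          have h3 : n + 1 ≠ b := Ne.symm hbn
          have h4 : b + 1 ≠ n := by omega
          simp [qgen, qoff, h1, h1.symm, h2, h3, h4, hbn]
    · ring
  rw [hS.tsum_eq]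
  have h0 : C⁻¹ * p n * S = 0 := hval.tsum_eq.symm.trans hzero
  exact (mul_eq_zero.1 h0).resolve_left (mul_pos (inv_pos.2 hCpos) (hp_pos n)).ne'
end
end

section
/- Assume K is finite, let N ≥ 1 and assume ε̃ := inf_{n≥N} (μ(n) − λ(n)) > 0. For each n ∈ ℕ let τ_n : K → ℝ satisfy τ_n = 0 on K_W, τ_n > 0 on K_B, and the first-entrance equations, and let c : ℕ → ℝ satisfy c_* := inf_n c_n > 0 and, for every n ∈ ℕ and every k ∈ K_W: c_n·μ(n+1)·∑_{ℓ∈K_B} R_{n+1}(k,ℓ)·τ_n(ℓ) ≤ ε̃/4 and c_n·∑_{ℓ∈K_B} v_n(k,ℓ)·τ_n(ℓ) ≤ ε̃/4. Then L : E → ℝ≥0, L(n,k) = n + 1{k∈K_B}·c_n·τ_n(k), satisfies ∑_{z̃∈E} q((n,k); z̃)·L(z̃) ≤ −min(ε̃/2, c_*) for every (n,k) ∈ E with n ≥ N. (Corollary 4.10, drift form) -/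
open scoped Classical

noncomputable section

section Generator

variable {K : Type*} (KW : Set K) (lam mu : ℕ → ℝ) (R V : ℕ → K → K → ℝ) (m : ℕ) (k l : K)

theorem qoff_down : qoff KW lam mu R V (m + 1, k) (m, l) =
    if k ∈ KW then mu (m + 1) * R (m + 1) k l else 0 := by
  simp [qoff, show m ≠ m + 1 + 1 by omega]

theorem qoff_level : qoff KW lam mu R V (m + 1, k) (m + 1, l) =
    if l = k then 0 else V (m + 1) k l := by
  simp [qoff]

theorem qoff_up : qoff KW lam mu R V (m + 1, k) (m + 2, l) =
    if l = k then (if k ∈ KW then lam (m + 1) else 0) else 0 := by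
  by_cases h : l = k <;> simp [qoff, h]

variable {m} in
theorem qoff_eq_zero {j : ℕ} (h₀ : j ≠ m) (h₁ : j ≠ m + 1) (h₂ : j ≠ m + 2) :
    qoff KW lam mu R V (m + 1, k) (j, l) = 0 := by
  simp [qoff, h₀, h₁, h₂]

/-- A series over `ℕ × K` supported on three consecutive levels is a finite sum. -/
theorem tsum_three_levels [Fintype K] (f : ℕ × K → ℝ)
    (hf : ∀ j l, j ≠ m → j ≠ m + 1 → j ≠ m + 2 → f (j, l) = 0) :
    ∑' z, f z = ∑ l, f (m, l) + ∑ l, f (m + 1, l) + ∑ l, f (m + 2, l) := by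
  rw [tsum_eq_sum (s := ({m, m + 1, m + 2} : Finset ℕ) ×ˢ Finset.univ), Finset.sum_product,
    Finset.sum_insert (by simp), Finset.sum_insert (by simp), Finset.sum_singleton, add_assoc]
  rintro ⟨j, l⟩ hj
  simp only [Finset.mem_product, Finset.mem_insert, Finset.mem_singleton, Finset.mem_univ,
    and_true, not_or] at hj
  exact hf j l hj.1 hj.2.1 hj.2.2

/-- The action of the generator on an arbitrary function, at a positive level. -/
theorem tsum_qgen_mul [Fintype K] (L : ℕ × K → ℝ) :
    ∑' z, qgen KW lam mu R V (m + 1, k) z * L z =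
      (if k ∈ KW then lam (m + 1) * (L (m + 2, k) - L (m + 1, k)) +
        mu (m + 1) * ∑ l, R (m + 1) k l * (L (m, l) - L (m + 1, k)) else 0) +
      ∑ l, V (m + 1) k l * (L (m + 1, l) - L (m + 1, k)) := by
  have hq (z : ℕ × K) : qgen KW lam mu R V (m + 1, k) z * L z =
      qoff KW lam mu R V (m + 1, k) z * L z +
        if z = (m + 1, k) then -(∑' w, qoff KW lam mu R V (m + 1, k) w) * L (m + 1, k)
        else 0 := by
    by_cases h : z = (m + 1, k)
    · subst h
      simp [qgen, qoff]
    · simp [qgen, h]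
  rw [tsum_congr hq, tsum_three_levels m _ fun j l h₀ h₁ h₂ => by
      rw [qoff_eq_zero KW lam mu R V k l h₀ h₁ h₂]; simp [h₁],
    tsum_three_levels m _ fun j l h₀ h₁ h₂ => qoff_eq_zero KW lam mu R V k l h₀ h₁ h₂]
  have hV : ∑ l, V (m + 1) k l * (L (m + 1, l) - L (m + 1, k)) =
      ∑ l, (if l = k then 0 else V (m + 1) k l) * (L (m + 1, l) - L (m + 1, k)) :=
    Finset.sum_congr rfl fun l _ => by by_cases h : l = k <;> simp [h]
  rw [hV]
  simp only [qoff_down, qoff_level, qoff_up, Finset.sum_add_distrib, mul_sub,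
    Finset.sum_sub_distrib, ← Finset.sum_mul]
  by_cases hk : k ∈ KW
  · simp [hk, ← Finset.mul_sum, mul_assoc]
    ring
  · simp [hk]
    ring

end Generator

/-- Corollary 4.10 (drift form): if `ε̃ := inf_{n≥N}(μ(n) − λ(n)) > 0` and the constants
`c_n` satisfy `inf_n c_n > 0` and the `ε̃/4` bounds, then `L(n,k) = n + 1{k∈K_B}·c_n·τ_n(k)`
satisfies `(QL)(n,k) ≤ −min(ε̃/2, inf_m c_m)` for all `(n,k)` with `n ≥ N`. -/
theorem linear_lyapunov_drift
    {K : Type*} [Fintype K] [Nonempty K]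
    (KW : Set K) (hKW : KW.Nonempty)
    (lam mu : ℕ → ℝ) (R V : ℕ → K → K → ℝ)
    (hlam : ∀ n, 0 < lam n)
    (hmu0 : mu 0 = 0) (hmu : ∀ n, 0 < n → 0 < mu n)
    (hRnn : ∀ n, 0 < n → ∀ k m, 0 ≤ R n k m)
    (hRrow : ∀ n, 0 < n → ∀ k, ∑ m : K, R n k m = 1)
    (hVoff : ∀ n k m, m ≠ k → 0 ≤ V n k m)
    (hVrow : ∀ n k, ∑ m : K, V n k m = 0)
    (N : ℕ) (hN : 1 ≤ N)
    (et : ℝ) (hetdef : et = ⨅ n : {m : ℕ // N ≤ m}, (mu (n : ℕ) - lam (n : ℕ)))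
    (hetpos : 0 < et)
    (tau : ℕ → K → ℝ)
    (htauW : ∀ n, ∀ l ∈ KW, tau n l = 0)
    (htauB : ∀ n, ∀ l ∈ KWᶜ, 0 < tau n l)
    (htauFE : ∀ n, ∀ k ∈ KWᶜ, (-1 : ℝ) =
      (∑ l : K, if l ∈ KWᶜ ∧ l ≠ k then V n k l * (tau n l - tau n k) else 0)
        - (∑ l : K, if l ∈ KW then V n k l * tau n k else 0))
    (c : ℕ → ℝ) (hcinf : 0 < ⨅ n, c n)
    (hc1 : ∀ n, ∀ k ∈ KW,
      c n * (mu (n + 1) * ∑ l : K, (if l ∈ KWᶜ then R (n + 1) k l * tau n l else 0))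
        ≤ et / 4)
    (hc2 : ∀ n, ∀ k ∈ KW,
      c n * (∑ l : K, (if l ∈ KWᶜ then V n k l * tau n l else 0)) ≤ et / 4) :
    ∀ (n : ℕ) (k : K), N ≤ n →
      (∑' z : ℕ × K, qgen KW lam mu R V (n, k) z *
          ((z.1 : ℝ) + (if z.2 ∈ KWᶜ then c z.1 * tau z.1 z.2 else 0)))
        ≤ -(min (et / 2) (⨅ m, c m)) := by
  intro n k hn
  obtain ⟨m, rfl⟩ : ∃ m, n = m + 1 := ⟨n - 1, by omega⟩
  rw [tsum_qgen_mul KW lam mu R V m k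
    (fun z => (z.1 : ℝ) + if z.2 ∈ KWᶜ then c z.1 * tau z.1 z.2 else 0)]
  by_cases hk : k ∈ KW
  · have hdrift : et ≤ mu (m + 1) - lam (m + 1) := by
      have hbdd : BddBelow (Set.range fun n : {i : ℕ // N ≤ i} => mu (n : ℕ) - lam (n : ℕ)) := by
        by_contra h
        rw [hetdef, Real.iInf_of_not_bddBelow h] at hetpos
        exact hetpos.false
      exact hetdef.trans_le (ciInf_le hbdd ⟨m + 1, hn⟩)
    have hdown : ∑ l, R (m + 1) k l *
          ((m : ℝ) + (if l ∈ KWᶜ then c m * tau m l else 0) - ((m : ℝ) + 1)) =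
        c m * (∑ l, if l ∈ KWᶜ then R (m + 1) k l * tau m l else 0) - 1 := by
      rw [← hRrow (m + 1) m.succ_pos k, Finset.mul_sum, ← Finset.sum_sub_distrib]
      refine Finset.sum_congr rfl fun l _ => ?_
      rw [hRrow (m + 1) m.succ_pos k]
      split_ifs <;> ring
    have hlevel : ∑ l, V (m + 1) k l *
          ((m : ℝ) + 1 + (if l ∈ KWᶜ then c (m + 1) * tau (m + 1) l else 0) - ((m : ℝ) + 1)) =
        c (m + 1) * ∑ l, if l ∈ KWᶜ then V (m + 1) k l * tau (m + 1) l else 0 := by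
      rw [Finset.mul_sum]
      refine Finset.sum_congr rfl fun l _ => ?_
      split_ifs <;> ring
    have hkc : k ∉ KWᶜ := fun h => h hk
    simp only [if_pos hk, if_neg hkc, add_zero, Nat.cast_add, Nat.cast_one, Nat.cast_ofNat]
    rw [hdown, hlevel]
    have h₁ := hc1 m k hk
    have h₂ := hc2 (m + 1) k hk
    have hmin := min_le_left (et / 2) (⨅ m, c m)
    linarith
  · have hc : ⨅ m, c m ≤ c (m + 1) := by
      have hbdd : BddBelow (Set.range c) := by
        by_contra h
        rw [Real.iInf_of_not_bddBelow h] at hcinf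
        exact hcinf.false
      exact ciInf_le hbdd (m + 1)
    have hlevel : ∑ l, V (m + 1) k l *
          ((m : ℝ) + 1 + (if l ∈ KWᶜ then c (m + 1) * tau (m + 1) l else 0) -
            ((m : ℝ) + 1 + c (m + 1) * tau (m + 1) k)) = c (m + 1) * (-1) := by
      rw [htauFE (m + 1) k hk, ← Finset.sum_sub_distrib, Finset.mul_sum]
      refine Finset.sum_congr rfl fun l _ => ?_
      by_cases hl : l ∈ KW
      · simp [hl]
        ring
      · by_cases hlk : l = k
        · simp [hlk, hk]
        · simp [hl, hlk]
          ring
    have hkc : k ∈ KWᶜ := hk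
    simp only [if_neg hk, if_pos hkc, zero_add, Nat.cast_add, Nat.cast_one]
    rw [hlevel]
    have hmin := min_le_right (et / 2) (⨅ m, c m)
    linarith
end
end
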